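/- Let 2 ≤ p₁ < p₂ < ∞ and set θ = (1/p₁ − 1/p₂)/(1/2 − 1/p₂). Then there exist constants c₂ ≥ c₁ > 0, depending only on p₁ and p₂, such that for every N ∈ ℕ and every k ∈ ℕ with k ≤ N one has c₁ · ξ^θ ≤ d_k(id : ℓ_{p₁}^N → ℓ_{p₂}^N) ≤ c₂ · ξ^θ, where ξ = min(1, N^{1/p₂} k^{−1/2}). -/

import Mathlib

open scoped ENNReal

/-- The `k`-th Kolmogorov number of a continuous linear operator `T : X → Y`. -/
noncomputable def kolmogorovNumber {X Y : Type*} [NormedAddCommGroup X] [NormedSpace ℂ X]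
    [NormedAddCommGroup Y] [NormedSpace ℂ Y] (T : X →L[ℂ] Y) (k : ℕ) : ℝ :=
  sInf { r | ∃ L : Submodule ℂ Y, Module.rank ℂ L < (k : Cardinal) ∧
    r = ⨆ x : {x : X // ‖x‖ ≤ 1}, ⨅ z : L, ‖T x.1 - (z : Y)‖ }

/-- The identity operator `id : ℓ_{p₁}^N → ℓ_{p₂}^N` on `ℂ^N`. -/
noncomputable def lpId (p₁ p₂ : ℝ≥0∞) [Fact (1 ≤ p₁)] [Fact (1 ≤ p₂)] (N : ℕ) :
    PiLp p₁ (fun _ : Fin N => ℂ) →L[ℂ] PiLp p₂ (fun _ : Fin N => ℂ) :=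
  LinearMap.toContinuousLinearMap
    (((WithLp.linearEquiv p₂ ℂ (Fin N → ℂ)).symm.toLinearMap).comp
      (WithLp.linearEquiv p₁ ℂ (Fin N → ℂ)).toLinearMap)

/-- The real vector of signs attached to `ε`. -/
def signVec {n : Type*} (ε : n → ℤˣ) : n → ℝ := fun j => ((ε j : ℤ) : ℝ)

lemma signVec_neg {n : Type*} (ε : n → ℤˣ) : signVec (-ε) = -signVec ε := by
  ext j; simp [signVec]

lemma signVec_eq_or {n : Type*} (ε : n → ℤˣ) (j : n) : signVec ε j = 1 ∨ signVec ε j = -1 := by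
  rcases Int.units_eq_one_or (ε j) with h | h <;> simp [signVec, h]

section SignAverage

variable {n : Type*} [Fintype n] [DecidableEq n]

/-- The average of `f` over all sign vectors. -/
noncomputable def signMean (f : (n → ℝ) → ℝ) : ℝ :=
  (Fintype.card (n → ℤˣ) : ℝ)⁻¹ * ∑ ε : n → ℤˣ, f (signVec ε)

lemma signMean_mono {f g : (n → ℝ) → ℝ} (h : ∀ ε : n → ℤˣ, f (signVec ε) ≤ g (signVec ε)) :
    signMean f ≤ signMean g := by
  unfold signMean
  gcongr with ε
  exact h ε

lemma signMean_add (f g : (n → ℝ) → ℝ) :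
    signMean (fun a => f a + g a) = signMean f + signMean g := by
  simp [signMean, Finset.sum_add_distrib, mul_add]

lemma signMean_const_mul (c : ℝ) (f : (n → ℝ) → ℝ) :
    signMean (fun a => c * f a) = c * signMean f := by
  simp only [signMean, ← Finset.mul_sum]; ring

lemma signMean_const (c : ℝ) : signMean (fun _ : n → ℝ => c) = c := by
  simp [signMean]

lemma signMean_neg (f : (n → ℝ) → ℝ) : signMean (fun a => f (-a)) = signMean f := by
  unfold signMean
  congr 1
  simp only [← signVec_neg]
  exact Equiv.sum_comp (Equiv.neg (n → ℤˣ)) fun ε => f (signVec ε)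

/-- Averaging over a random step `2 ε` with `ε` a sign vector. -/
noncomputable def signStep : ((n → ℝ) → ℝ) →ₗ[ℝ] ((n → ℝ) → ℝ) :=
  (Fintype.card (n → ℤˣ) : ℝ)⁻¹ •
    ∑ ε : n → ℤˣ, LinearMap.funLeft ℝ ℝ fun b : n → ℝ => b + (2 : ℝ) • signVec ε

lemma signStep_apply (G : (n → ℝ) → ℝ) (b : n → ℝ) :
    signStep G b = signMean fun a => G (b + (2 : ℝ) • a) := by
  simp [signStep, signMean, LinearMap.funLeft_apply]

/-- A symmetrization and contraction argument: if `G` dominates the linear perturbations of `h`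
on `K`, some choice of `m` sign vectors satisfies a one-sided uniform law of large numbers. -/
lemma exists_signVec_deviation (K : Set (n → ℝ)) (m : ℕ) (h : (n → ℝ) → ℝ) (G : (n → ℝ) → ℝ)
    (hG : ∀ u ∈ K, ∀ b, h u + b ⬝ᵥ u ≤ G b) :
    ∃ a : Fin m → n → ℝ, ∀ u ∈ K,
      h u + m * signMean (fun b => |b ⬝ᵥ u|) - ∑ i, |a i ⬝ᵥ u| ≤ (signStep ^ m) G 0 := by
  induction m generalizing h G with
  | zero =>
    exact ⟨fun _ => 0, fun u hu => by simpa using hG u hu 0⟩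
  | succ m ih =>
    let M : (n → ℝ) → (n → ℝ) → ℝ := fun a b =>
      max (G (b + (2 : ℝ) • a)) (G (b - (2 : ℝ) • a))
    let M' : (n → ℝ) → (n → ℝ) → ℝ := fun a b =>
      min (G (b + (2 : ℝ) • a)) (G (b - (2 : ℝ) • a))
    let G' : (n → ℝ) → (n → ℝ) → ℝ := fun a b =>
      (1 / 2) * signMean (fun a' => M a' b) + (1 / 2) * M' a b
    have hG' : ∀ a : n → ℝ, ∀ u ∈ K, ∀ b,
        (h u + signMean (fun b => |b ⬝ᵥ u|) - |a ⬝ᵥ u|) + b ⬝ᵥ u ≤ G' a b := by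
      intro a u hu b
      have key : ∀ a : n → ℝ, h u + b ⬝ᵥ u + 2 * (a ⬝ᵥ u) ≤ G (b + (2 : ℝ) • a) ∧
          h u + b ⬝ᵥ u - 2 * (a ⬝ᵥ u) ≤ G (b - (2 : ℝ) • a) := fun a => by
        constructor
        · have := hG u hu (b + (2 : ℝ) • a)
          rw [add_dotProduct, smul_dotProduct, smul_eq_mul] at this
          linarith
        · have := hG u hu (b - (2 : ℝ) • a)
          rw [sub_dotProduct, smul_dotProduct, smul_eq_mul] at this
          linarith
      have h1 : signMean (fun a' => (h u + b ⬝ᵥ u) + 2 * |a' ⬝ᵥ u|) ≤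
          signMean (fun a' => M a' b) := by
        refine signMean_mono fun ε => ?_
        obtain ⟨k1, k2⟩ := key (signVec ε)
        rcases abs_cases (signVec ε ⬝ᵥ u) with ⟨e, _⟩ | ⟨e, _⟩ <;> rw [e]
        · exact le_max_of_le_left k1
        · exact le_max_of_le_right (by linarith)
      rw [signMean_add, signMean_const, signMean_const_mul] at h1
      have h2 : h u + b ⬝ᵥ u - 2 * |a ⬝ᵥ u| ≤ M' a b := by
        obtain ⟨k1, k2⟩ := key a
        refine le_min ?_ ?_
        · linarith [neg_abs_le (a ⬝ᵥ u)]
        · linarith [le_abs_self (a ⬝ᵥ u)]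
      simp only [G']
      linarith
    have hmean : ∀ b, signMean (fun a => G' a b) = signStep G b := by
      intro b
      have e1 : signMean (fun a => G' a b) =
          (1 / 2) * signMean (fun a => M a b + M' a b) := by
        simp only [G', signMean_add, signMean_const_mul, signMean_const]
        ring
      have e2 : (fun a => M a b + M' a b) =
          fun a => G (b + (2 : ℝ) • a) + G (b + (2 : ℝ) • (-a)) := by
        ext a
        simp only [M, M', max_add_min, smul_neg, sub_eq_add_neg]
      rw [e1, e2, signMean_add, signMean_neg (fun a => G (b + (2 : ℝ) • a)), signStep_apply]
      ring
    have hstep : signMean (fun a => (signStep ^ m) (G' a) 0) = (signStep ^ (m + 1)) G 0 := by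
      have : signStep G =
          (Fintype.card (n → ℤˣ) : ℝ)⁻¹ • ∑ ε : n → ℤˣ, G' (signVec ε) := by
        ext b
        rw [← hmean b]
        simp [signMean]
      rw [pow_succ, Module.End.mul_apply, this, map_smul, map_sum]
      simp [signMean]
    obtain ⟨ε, hε⟩ : ∃ ε : n → ℤˣ,
        (signStep ^ m) (G' (signVec ε)) 0 ≤ (signStep ^ (m + 1)) G 0 := by
      by_contra! hcon
      have : ∑ ε : n → ℤˣ, (signStep ^ (m + 1)) G 0 <
          ∑ ε : n → ℤˣ, (signStep ^ m) (G' (signVec ε)) 0 :=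
        Finset.sum_lt_sum_of_nonempty Finset.univ_nonempty fun ε _ => hcon ε
      rw [← hstep] at this
      simp only [signMean, Finset.sum_const, Finset.card_univ, nsmul_eq_mul] at this
      rw [← mul_assoc, mul_inv_cancel₀ (by positivity), one_mul] at this
      exact lt_irrefl _ this
    obtain ⟨a, ha⟩ := ih _ (G' (signVec ε)) (hG' (signVec ε))
    refine ⟨Fin.cons (signVec ε) a, fun u hu => ?_⟩
    have := ha u hu
    rw [Fin.sum_univ_succ]
    simp only [Fin.cons_zero, Fin.cons_succ]
    push_cast
    linarith

end SignAverage

section Khinchine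

variable {n : Type*} [Fintype n] [DecidableEq n]

lemma signMean_cos (u : n → ℝ) :
    signMean (fun a => Real.cos (a ⬝ᵥ u)) = ∏ j, Real.cos (u j) := by
  have h := Finset.prod_univ_sum (fun _ : n => (Finset.univ : Finset ℤˣ))
    (fun j e => Complex.exp ((((e : ℤ) : ℝ) * u j : ℝ) * Complex.I))
  simp only [Fintype.piFinset_univ, ← Complex.exp_sum, ← Finset.sum_mul, ← Complex.ofReal_sum] at h
  have h2 : ∀ j, ∑ e : ℤˣ, Complex.exp ((((e : ℤ) : ℝ) * u j : ℝ) * Complex.I) =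
      ((2 * Real.cos (u j) : ℝ) : ℂ) := by
    intro j
    rw [show (Finset.univ : Finset ℤˣ) = {1, -1} from rfl, Finset.sum_pair (by decide)]
    push_cast
    rw [Complex.two_cos]
    simp
  simp only [h2, ← Complex.ofReal_prod] at h
  have h3 := congrArg Complex.re h
  simp only [Complex.ofReal_re, Complex.re_sum, Complex.exp_ofReal_mul_I_re,
    Finset.prod_mul_distrib, Finset.prod_const, Finset.card_univ] at h3
  simp only [signMean, signVec, dotProduct, ← h3, Fintype.card_fun, Fintype.card_units_int]
  push_cast
  rw [← mul_assoc, inv_mul_cancel₀ (by positivity), one_mul]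

lemma one_sub_exp_le_signMean_abs (u : n → ℝ) (hu : ∑ j, u j ^ 2 = 1) :
    1 - Real.exp (-(2 / Real.pi ^ 2)) ≤ signMean fun a => |a ⬝ᵥ u| := by
  have h1 : signMean (fun a : n → ℝ => 1 + (-1) * Real.cos (a ⬝ᵥ u)) ≤
      signMean fun a => |a ⬝ᵥ u| := by
    refine signMean_mono fun ε => ?_
    set x := signVec ε ⬝ᵥ u
    have e : Real.cos x = 1 - 2 * Real.sin (x / 2) ^ 2 := by
      rw [← Real.cos_sq_add_sin_sq (x / 2), show x = 2 * (x / 2) by ring, Real.cos_two_mul]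
      ring_nf
      nlinarith [Real.sin_sq_add_cos_sq (x * (1 / 2))]
    have s1 : |Real.sin (x / 2)| ≤ |x / 2| := Real.abs_sin_le_abs
    have s2 : |Real.sin (x / 2)| ≤ 1 := Real.abs_sin_le_one _
    rw [e, ← sq_abs (Real.sin (x / 2))]
    rw [abs_div, abs_two] at s1
    nlinarith [abs_nonneg (Real.sin (x / 2))]
  rw [signMean_add, signMean_const, signMean_const_mul, signMean_cos] at h1
  have hj : ∀ j, |u j| ≤ 1 := fun j => by
    rw [← sq_le_one_iff_abs_le_one, ← hu]
    exact Finset.single_le_sum (f := fun j => u j ^ 2) (fun i _ => sq_nonneg _) (Finset.mem_univ j)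
  have h2 : ∏ j, Real.cos (u j) ≤ ∏ j, Real.exp (-(2 / Real.pi ^ 2) * u j ^ 2) := by
    refine Finset.prod_le_prod (fun j _ => ?_) (fun j _ => ?_)
    · have := abs_le.1 (hj j)
      exact Real.cos_nonneg_of_mem_Icc
        ⟨by linarith [Real.pi_gt_three], by linarith [Real.pi_gt_three]⟩
    · have := Real.cos_le_one_sub_mul_cos_sq ((hj j).trans (by linarith [Real.pi_gt_three]))
      linarith [Real.add_one_le_exp (-(2 / Real.pi ^ 2) * u j ^ 2)]
  rw [← Real.exp_sum, ← Finset.mul_sum, hu, mul_one] at h2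
  linarith

/-- Khinchine's inequality in `L¹`. -/
lemma sqrt_sum_sq_le_signMean_abs (u : n → ℝ) :
    (1 - Real.exp (-(2 / Real.pi ^ 2))) * √(∑ j, u j ^ 2) ≤ signMean fun a => |a ⬝ᵥ u| := by
  rcases (Finset.sum_nonneg fun j (_ : j ∈ Finset.univ) => sq_nonneg (u j)).eq_or_lt with h | h
  · rw [← h, Real.sqrt_zero, mul_zero]
    exact mul_nonneg (by positivity) (Finset.sum_nonneg fun _ _ => abs_nonneg _)
  · set s := √(∑ j, u j ^ 2) with hs
    have hs0 : 0 < s := Real.sqrt_pos.2 h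
    have h1 := one_sub_exp_le_signMean_abs (s⁻¹ • u) (by
      simp only [Pi.smul_apply, smul_eq_mul, mul_pow, ← Finset.mul_sum]
      rw [hs, inv_pow, Real.sq_sqrt h.le, inv_mul_cancel₀ h.ne'])
    simp only [dotProduct_smul, smul_eq_mul, abs_mul, signMean_const_mul] at h1
    rw [abs_of_pos (inv_pos.2 hs0), inv_mul_eq_div, le_div_iff₀ hs0] at h1
    exact h1

end Khinchine

/-- `x ^ q` is dominated by `cosh x`. -/
lemma rpow_le_mul_cosh {q : ℝ} (hq : 0 < q) {x : ℝ} (hx : 0 ≤ x) :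
    x ^ q ≤ 2 * q ^ q * Real.cosh x := by
  have h1 : x / q ≤ Real.exp (x / q) := by linarith [Real.add_one_le_exp (x / q)]
  have h2 : (x / q) ^ q ≤ Real.exp x := by
    calc (x / q) ^ q ≤ Real.exp (x / q) ^ q := by gcongr
      _ = Real.exp x := by rw [← Real.exp_mul, div_mul_cancel₀ _ hq.ne']
  rw [Real.div_rpow hx hq.le, div_le_iff₀ (by positivity)] at h2
  have h3 : Real.exp x ≤ 2 * Real.cosh x := by
    rw [Real.cosh_eq]; linarith [Real.exp_pos (-x)]
  calc x ^ q ≤ Real.exp x * q ^ q := h2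
    _ ≤ 2 * Real.cosh x * q ^ q := by gcongr
    _ = _ := by ring

lemma rpow_inv_le_add {q R S : ℝ} (hq : 1 ≤ q) (hR : 0 < R) (hS : 0 ≤ S) :
    S ^ (1 / q) ≤ R + R ^ (1 - q) * S := by
  have hq0 : 0 < q := by linarith
  set x := S ^ (1 / q)
  have hx : 0 ≤ x := by positivity
  have hS' : S = x ^ q := by rw [← Real.rpow_mul hS, one_div_mul_cancel hq0.ne', Real.rpow_one]
  rcases le_total x R with h | h
  · have : 0 ≤ R ^ (1 - q) * S := by positivity
    linarith
  · have hx0 : 0 < x := hR.trans_le h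
    have h1 : x ^ (1 - q) ≤ R ^ (1 - q) := Real.rpow_le_rpow_of_nonpos hR h (by linarith)
    have h2 : x = x ^ (1 - q) * x ^ q := by
      rw [← Real.rpow_add hx0]; simp
    have h3 : x ^ (1 - q) * x ^ q ≤ R ^ (1 - q) * x ^ q := by gcongr
    rw [hS']
    linarith

lemma sum_rpow_inv_le_potential {n : Type*} [Fintype n] [Nonempty n] {q : ℝ} (hq : 1 ≤ q)
    {m : ℕ} (hm : 0 < m) (b : n → ℝ) :
    (∑ j, |b j| ^ q) ^ (1 / q) ≤
      (Fintype.card n : ℝ) ^ (1 / q) * √m + (Fintype.card n : ℝ) ^ (1 / q) * √m *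
        (Fintype.card n : ℝ)⁻¹ * (2 * q ^ q) * ∑ j, Real.cosh ((√m)⁻¹ * b j) := by
  have hq0 : 0 < q := by linarith
  have hN : (0 : ℝ) < Fintype.card n := by exact_mod_cast Fintype.card_pos
  have hm' : 0 < √(m : ℝ) := Real.sqrt_pos.2 (by exact_mod_cast hm)
  set R := (Fintype.card n : ℝ) ^ (1 / q) * √m with hR
  have hR0 : 0 < R := by positivity
  refine (rpow_inv_le_add hq hR0 (by positivity)).trans ?_
  have h1 : ∑ j, |b j| ^ q ≤ √m ^ q * ((2 * q ^ q) * ∑ j, Real.cosh ((√m)⁻¹ * b j)) := by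
    rw [Finset.mul_sum, Finset.mul_sum]
    gcongr with j
    have := rpow_le_mul_cosh hq0 (x := (√m)⁻¹ * |b j|) (by positivity)
    rw [← abs_of_pos (inv_pos.2 hm'), ← abs_mul, Real.cosh_abs, abs_mul,
      abs_of_pos (inv_pos.2 hm'), Real.mul_rpow (by positivity) (by positivity),
      Real.inv_rpow hm'.le, inv_mul_le_iff₀ (by positivity)] at this
    exact this
  have h2 : R ^ (1 - q) * √m ^ q = R * (Fintype.card n : ℝ)⁻¹ := by
    rw [Real.rpow_sub hR0, Real.rpow_one, hR, Real.mul_rpow (by positivity) hm'.le,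
      ← Real.rpow_mul hN.le, one_div_mul_cancel hq0.ne', Real.rpow_one]
    field_simp
  calc R + R ^ (1 - q) * ∑ j, |b j| ^ q
      ≤ R + R ^ (1 - q) * (√m ^ q * ((2 * q ^ q) * ∑ j, Real.cosh ((√m)⁻¹ * b j))) := by gcongr
    _ = R + (R ^ (1 - q) * √m ^ q) * ((2 * q ^ q) * ∑ j, Real.cosh ((√m)⁻¹ * b j)) := by ring
    _ = _ := by rw [h2]; ring

section Potential

variable {n : Type*} [Fintype n] [DecidableEq n]

lemma signStep_const (c : ℝ) : signStep (fun _ : n → ℝ => c) = fun _ => c := by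
  ext b; rw [signStep_apply, signMean_const]

lemma signStep_pow_const (m : ℕ) (c : ℝ) :
    (signStep ^ m) (fun _ : n → ℝ => c) = fun _ => c := by
  induction m with
  | zero => rfl
  | succ m ih => rw [pow_succ, Module.End.mul_apply, signStep_const, ih]

lemma signStep_cosh (t : ℝ) (j : n) :
    signStep (fun b : n → ℝ => Real.cosh (t * b j)) =
      Real.cosh (2 * t) • fun b : n → ℝ => Real.cosh (t * b j) := by
  ext b
  rw [signStep_apply]
  have h : signMean (fun a : n → ℝ => Real.cosh (t * (b + (2 : ℝ) • a) j)) =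
      (1 / 2) * signMean (fun a : n → ℝ => Real.cosh (t * (b + (2 : ℝ) • a) j) +
        Real.cosh (t * (b + (2 : ℝ) • (-a)) j)) := by
    rw [signMean_add, signMean_neg fun a : n → ℝ => Real.cosh (t * (b + (2 : ℝ) • a) j)]
    ring
  rw [h, ← signMean_const_mul, Pi.smul_apply, smul_eq_mul,
    ← signMean_const (n := n) (Real.cosh (2 * t) * Real.cosh (t * b j))]
  refine le_antisymm (signMean_mono fun ε => le_of_eq ?_) (signMean_mono fun ε => le_of_eq ?_) <;>
  · rcases signVec_eq_or ε j with e | e <;>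
    · simp only [Pi.add_apply, Pi.smul_apply, Pi.neg_apply, e, smul_eq_mul, mul_add, Real.cosh_add]
      simp only [mul_neg, neg_neg, Real.cosh_neg, Real.sinh_neg, mul_one, mul_comm t 2]
      ring

lemma signStep_pow_cosh (m : ℕ) (t : ℝ) (j : n) :
    (signStep ^ m) (fun b : n → ℝ => Real.cosh (t * b j)) =
      Real.cosh (2 * t) ^ m • fun b : n → ℝ => Real.cosh (t * b j) := by
  induction m with
  | zero => simp
  | succ m ih =>
    rw [pow_succ, Module.End.mul_apply, signStep_cosh, map_smul, ih, smul_smul, pow_succ, mul_comm]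

lemma signStep_pow_potential (m : ℕ) (t R D : ℝ) :
    (signStep ^ m) (fun b : n → ℝ => R + D * ∑ j, Real.cosh (t * b j)) 0 =
      R + D * (Fintype.card n * Real.cosh (2 * t) ^ m) := by
  have : (fun b : n → ℝ => R + D * ∑ j, Real.cosh (t * b j)) =
      (fun _ => R) + D • ∑ j, fun b : n → ℝ => Real.cosh (t * b j) := by
    ext b; simp
  rw [this, map_add, map_smul, map_sum, signStep_pow_const]
  simp [signStep_pow_cosh]

/-- Low `M*`-type estimate: there are `m` vectors whose common orthogonal complement meets the
polar of the unit ball of `ℓ_q` in a set of small Euclidean diameter. -/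
lemma exists_vectors_sqrt_sum_sq_le [Nonempty n] {q : ℝ} (hq : 1 ≤ q) {m : ℕ} (hm : 0 < m) :
    ∃ a : Fin m → n → ℝ, ∀ u : n → ℝ, (∀ b : n → ℝ, b ⬝ᵥ u ≤ (∑ j, |b j| ^ q) ^ (1 / q)) →
      (∀ i, a i ⬝ᵥ u = 0) →
      √(∑ j, u j ^ 2) ≤ (1 + 2 * q ^ q * Real.exp 2) / (1 - Real.exp (-(2 / Real.pi ^ 2))) *
        ((Fintype.card n : ℝ) ^ (1 / q) * (√m)⁻¹) := by
  have hN : (0 : ℝ) < Fintype.card n := by exact_mod_cast Fintype.card_pos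
  have hm0 : (0 : ℝ) < m := by exact_mod_cast hm
  have hm' : 0 < √(m : ℝ) := Real.sqrt_pos.2 hm0
  have hc : 0 < 1 - Real.exp (-(2 / Real.pi ^ 2)) := by
    rw [sub_pos, Real.exp_lt_one_iff]
    exact neg_lt_zero.2 (by positivity)
  obtain ⟨a, ha⟩ := exists_signVec_deviation
    {u : n → ℝ | ∀ b : n → ℝ, b ⬝ᵥ u ≤ (∑ j, |b j| ^ q) ^ (1 / q)} m (fun _ => 0)
    (fun b => (Fintype.card n : ℝ) ^ (1 / q) * √m + (Fintype.card n : ℝ) ^ (1 / q) * √m *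
        (Fintype.card n : ℝ)⁻¹ * (2 * q ^ q) * ∑ j, Real.cosh ((√m)⁻¹ * b j))
    (fun u hu b => by rw [zero_add]; exact (hu b).trans (sum_rpow_inv_le_potential hq hm b))
  refine ⟨a, fun u hu hau => ?_⟩
  have h1 := ha u hu
  simp only [hau, abs_zero, Finset.sum_const_zero, sub_zero, zero_add,
    signStep_pow_potential] at h1
  have h2 : Real.cosh (2 * (√m)⁻¹) ^ m ≤ Real.exp 2 := by
    calc Real.cosh (2 * (√m)⁻¹) ^ m ≤ Real.exp ((2 * (√m)⁻¹) ^ 2 / 2) ^ m := by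
          gcongr
          exact Real.cosh_le_exp_half_sq _
      _ = Real.exp 2 := by
          rw [← Real.exp_nat_mul, mul_pow, inv_pow, Real.sq_sqrt hm0.le]
          congr 1
          field_simp
  have h3 := sqrt_sum_sq_le_signMean_abs u
  set s := √(∑ j, u j ^ 2)
  set R := (Fintype.card n : ℝ) ^ (1 / q) with hR
  have hR0 : 0 < R := by positivity
  set c := 1 - Real.exp (-(2 / Real.pi ^ 2))
  have h4 : m * (c * s) ≤ R * √m * (1 + 2 * q ^ q * Real.exp 2) := by
    calc m * (c * s) ≤ m * signMean (fun a => |a ⬝ᵥ u|) := by gcongr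
      _ ≤ _ := h1
      _ = R * √m * (1 + 2 * q ^ q * Real.cosh (2 * (√m)⁻¹) ^ m) := by field_simp
      _ ≤ _ := by gcongr
  rw [div_mul_eq_mul_div, le_div_iff₀ hc]
  have hmm : (m : ℝ) = √m * √m := (Real.mul_self_sqrt hm0.le).symm
  have h5 : √m * (s * c) ≤ √m * ((1 + 2 * q ^ q * Real.exp 2) * (R * (√m)⁻¹)) * 1 := by
    refine le_of_mul_le_mul_left ?_ hm'
    calc √m * (√m * (s * c)) = m * (c * s) := by rw [← mul_assoc, ← hmm]; ring
      _ ≤ _ := h4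
      _ = _ := by field_simp
  rw [mul_one] at h5
  exact le_of_mul_le_mul_left h5 hm'

end Potential

section Duality

lemma norm_sum_mul_le {n : Type*} [Fintype n] (c y : n → ℂ) :
    ‖∑ j, c j * y j‖ ≤
      (√(∑ j, (c j).re ^ 2) + √(∑ j, (c j).im ^ 2)) * √(∑ j, ‖y j‖ ^ 2) := by
  have h := Real.sum_mul_le_sqrt_mul_sqrt Finset.univ (fun j => |(c j).re|) (fun j => ‖y j‖)
  have h' := Real.sum_mul_le_sqrt_mul_sqrt Finset.univ (fun j => |(c j).im|) (fun j => ‖y j‖)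
  simp only [sq_abs] at h h'
  calc ‖∑ j, c j * y j‖ ≤ ∑ j, ‖c j * y j‖ := norm_sum_le _ _
    _ ≤ ∑ j, (|(c j).re| * ‖y j‖ + |(c j).im| * ‖y j‖) := by
        gcongr with j
        rw [norm_mul, ← add_mul]
        gcongr
        exact Complex.norm_le_abs_re_add_abs_im _
    _ ≤ _ := by rw [Finset.sum_add_distrib, add_mul]; gcongr

lemma exists_mem_dual_norm_sub_eq {E : Type*} [NormedAddCommGroup E] [NormedSpace ℂ E]
    [FiniteDimensional ℂ E] (L : Submodule ℂ E) (y : E) :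
    ∃ z ∈ L, ∃ f : StrongDual ℂ E, ‖f‖ ≤ 1 ∧ (∀ w ∈ L, f w = 0) ∧ ‖y - z‖ = ‖f y‖ := by
  have := FiniteDimensional.proper ℂ E
  obtain ⟨z, hz, hd⟩ :=
    (Submodule.closed_of_finiteDimensional L).exists_infDist_eq_dist ⟨0, L.zero_mem⟩ y
  obtain ⟨g, hg, hgy⟩ := exists_dual_vector'' ℂ (L.mkQ y)
  refine ⟨z, hz, LinearMap.mkContinuous (g.toLinearMap ∘ₗ L.mkQ) 1 fun x => ?_, ?_, ?_, ?_⟩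
  · exact (g.le_of_opNorm_le hg _).trans
      (mul_le_mul_of_nonneg_left (Submodule.Quotient.norm_mk_le L x) zero_le_one)
  · exact LinearMap.mkContinuous_norm_le _ zero_le_one _
  · intro w hw
    simp [(Submodule.Quotient.mk_eq_zero L).2 hw]
  · have h : ‖L.mkQ y‖ = Metric.infDist y L := QuotientAddGroup.norm_mk (S := L.toAddSubgroup) y
    simp only [LinearMap.mkContinuous_apply, LinearMap.comp_apply, ContinuousLinearMap.coe_coe, hgy]
    rw [RCLike.norm_ofReal, abs_of_nonneg (norm_nonneg _), h, hd, dist_eq_norm]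

lemma exists_submodule_norm_sub_le {p : ℝ≥0∞} [Fact (1 ≤ p)] (hp : p ≠ ∞) {N m : ℕ}
    (hN : 0 < N) (hm : 0 < m) :
    ∃ L : Submodule ℂ (PiLp p fun _ : Fin N => ℂ), Module.rank ℂ L ≤ m ∧ ∀ y, ∃ z ∈ L,
      ‖y - z‖ ≤ 2 * ((1 + 2 * p.toReal ^ p.toReal * Real.exp 2) /
        (1 - Real.exp (-(2 / Real.pi ^ 2))) * ((N : ℝ) ^ (1 / p.toReal) * (√m)⁻¹)) *
          √(∑ j, ‖y j‖ ^ 2) := by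
  have hp1 : 1 ≤ p.toReal := by
    rw [← ENNReal.toReal_one]
    exact ENNReal.toReal_mono hp Fact.out
  have : Nonempty (Fin N) := ⟨⟨0, hN⟩⟩
  obtain ⟨a, ha⟩ := exists_vectors_sqrt_sum_sq_le (n := Fin N) hp1 hm
  rw [Fintype.card_fin] at ha
  set ε := (1 + 2 * p.toReal ^ p.toReal * Real.exp 2) /
        (1 - Real.exp (-(2 / Real.pi ^ 2))) * ((N : ℝ) ^ (1 / p.toReal) * (√m)⁻¹)
  let emb : (Fin N → ℝ) → PiLp p fun _ : Fin N => ℂ := fun b => WithLp.toLp p fun j => (b j : ℂ)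
  refine ⟨Submodule.span ℂ (Set.range fun i => emb (a i)), ?_, fun y => ?_⟩
  · refine (rank_span_le _).trans (Cardinal.mk_range_le.trans ?_)
    simp
  obtain ⟨z, hz, f, hf, hfL, hfy⟩ :=
    exists_mem_dual_norm_sub_eq (Submodule.span ℂ (Set.range fun i => emb (a i))) y
  refine ⟨z, hz, ?_⟩
  let c : Fin N → ℂ := fun j => f (PiLp.single p j 1)
  have hfc : ∀ x, f x = ∑ j, c j * x j := by
    intro x
    have hx : x = ∑ j, x j • (PiLp.single p j 1 : PiLp p fun _ : Fin N => ℂ) := by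
      ext i
      simp [Pi.single_apply]
    conv_lhs => rw [hx, map_sum]
    simp [c, mul_comm]
  have hre : ∀ b : Fin N → ℝ, (f (emb b)).re = b ⬝ᵥ fun j => (c j).re := by
    intro b
    simp [hfc, emb, dotProduct, mul_comm]
  have him : ∀ b : Fin N → ℝ, (f (emb b)).im = b ⬝ᵥ fun j => (c j).im := by
    intro b
    simp [hfc, emb, dotProduct, mul_comm]
  have hnorm : ∀ b : Fin N → ℝ, ‖f (emb b)‖ ≤ (∑ j, |b j| ^ p.toReal) ^ (1 / p.toReal) := by
    intro b
    refine (f.le_of_opNorm_le hf _).trans (le_of_eq ?_)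
    rw [one_mul, PiLp.norm_eq_sum (by linarith)]
    simp [emb]
  have hmem : ∀ i, f (emb (a i)) = 0 := fun i => hfL _ (Submodule.subset_span ⟨i, rfl⟩)
  have h1 := ha (fun j => (c j).re)
    (fun b => by rw [← hre]; exact (Complex.re_le_norm _).trans (hnorm b))
    (fun i => by rw [← hre, hmem, Complex.zero_re])
  have h2 := ha (fun j => (c j).im)
    (fun b => by rw [← him]; exact (Complex.im_le_norm _).trans (hnorm b))
    (fun i => by rw [← him, hmem, Complex.zero_im])
  rw [hfy, hfc]
  refine (norm_sum_mul_le c y).trans ?_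
  gcongr
  linarith

end Duality

section PowerSums

variable {ι : Type*}

lemma rpow_sum_rpow_anti (s : Finset ι) {a : ι → ℝ} (ha : ∀ i, 0 ≤ a i) {r q : ℝ} (hr : 0 < r)
    (hrq : r ≤ q) :
    (∑ i ∈ s, a i ^ q) ^ (1 / q) ≤ (∑ i ∈ s, a i ^ r) ^ (1 / r) := by
  have hq : 0 < q := hr.trans_le hrq
  have hS : 0 ≤ ∑ i ∈ s, a i ^ r := Finset.sum_nonneg fun i _ => Real.rpow_nonneg (ha i) _
  set B := (∑ i ∈ s, a i ^ r) ^ (1 / r) with hB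
  have hB0 : 0 ≤ B := by positivity
  have hBr : B ^ r = ∑ i ∈ s, a i ^ r := by
    rw [hB, ← Real.rpow_mul hS, one_div_mul_cancel hr.ne', Real.rpow_one]
  have hle : ∀ i ∈ s, a i ≤ B := fun i hi => by
    rw [← Real.rpow_le_rpow_iff (ha i) hB0 hr, hBr]
    exact Finset.single_le_sum (f := fun i => a i ^ r)
      (fun i _ => Real.rpow_nonneg (ha i) _) hi
  have h1 : ∑ i ∈ s, a i ^ q ≤ B ^ q := by
    have hsplit : ∀ x : ℝ, 0 ≤ x → x ^ q = x ^ r * x ^ (q - r) := fun x hx => by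
      rw [← Real.rpow_add_of_nonneg hx hr.le (by linarith)]; congr 1; ring
    calc ∑ i ∈ s, a i ^ q = ∑ i ∈ s, a i ^ r * a i ^ (q - r) :=
          Finset.sum_congr rfl fun i _ => hsplit _ (ha i)
      _ ≤ ∑ i ∈ s, a i ^ r * B ^ (q - r) := by
          refine Finset.sum_le_sum fun i hi => ?_
          exact mul_le_mul_of_nonneg_left (Real.rpow_le_rpow (ha i) (hle i hi) (by linarith))
            (Real.rpow_nonneg (ha i) _)
      _ = B ^ q := by rw [← Finset.sum_mul, ← hBr, ← hsplit _ hB0]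
  calc (∑ i ∈ s, a i ^ q) ^ (1 / q) ≤ (B ^ q) ^ (1 / q) := by
        refine Real.rpow_le_rpow (Finset.sum_nonneg fun i _ => Real.rpow_nonneg (ha i) _) h1 ?_
        positivity
    _ = B := by rw [← Real.rpow_mul hB0, mul_one_div_cancel hq.ne', Real.rpow_one]

lemma rpow_sum_rpow_le_card_mul (s : Finset ι) {a : ι → ℝ} (ha : ∀ i, 0 ≤ a i) {r q : ℝ}
    (hr : 0 < r) (hrq : r ≤ q) :
    (∑ i ∈ s, a i ^ r) ^ (1 / r) ≤
      (s.card : ℝ) ^ (1 / r - 1 / q) * (∑ i ∈ s, a i ^ q) ^ (1 / q) := by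
  have hq : 0 < q := hr.trans_le hrq
  have h := Real.rpow_sum_le_const_mul_sum_rpow_of_nonneg s (f := fun i => a i ^ r) (p := q / r)
    ((one_le_div hr).2 hrq) fun i _ => Real.rpow_nonneg (ha i) _
  have e : ∀ i, (a i ^ r) ^ (q / r) = a i ^ q := fun i => by
    rw [← Real.rpow_mul (ha i), mul_div_cancel₀ _ hr.ne']
  simp only [e] at h
  have hS : 0 ≤ ∑ i ∈ s, a i ^ r := Finset.sum_nonneg fun i _ => Real.rpow_nonneg (ha i) _
  have hS' : 0 ≤ ∑ i ∈ s, a i ^ q := Finset.sum_nonneg fun i _ => Real.rpow_nonneg (ha i) _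
  have h2 := Real.rpow_le_rpow (by positivity) h (by positivity : 0 ≤ 1 / q)
  rw [← Real.rpow_mul hS, Real.mul_rpow (by positivity) hS', ← Real.rpow_mul (by positivity)] at h2
  convert! h2 using 2
  · field_simp
  · congr 1
    field_simp

end PowerSums

section KolmogorovNumber

variable {X Y : Type*} [NormedAddCommGroup X] [NormedSpace ℂ X]
  [NormedAddCommGroup Y] [NormedSpace ℂ Y]

lemma kolmogorovNumber_le (T : X →L[ℂ] Y) {k : ℕ} {r : ℝ} (L : Submodule ℂ Y)
    (hL : Module.rank ℂ L < (k : Cardinal))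
    (h : ∀ x : X, ‖x‖ ≤ 1 → ∃ z ∈ L, ‖T x - z‖ ≤ r) : kolmogorovNumber T k ≤ r := by
  have hbdd : ∀ x : X, BddBelow (Set.range fun z : L => ‖T x - (z : Y)‖) := fun x =>
    ⟨0, by rintro _ ⟨z, rfl⟩; exact norm_nonneg _⟩
  have : Nonempty {x : X // ‖x‖ ≤ 1} := ⟨⟨0, by simp⟩⟩
  unfold kolmogorovNumber
  refine csInf_le_of_le ⟨0, ?_⟩ ⟨L, hL, rfl⟩ (ciSup_le fun x => ?_)
  · rintro _ ⟨L', -, rfl⟩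
    exact Real.iSup_nonneg fun x => Real.iInf_nonneg fun z => norm_nonneg _
  · obtain ⟨z, hz, hr⟩ := h x.1 x.2
    exact (ciInf_le (hbdd x.1) ⟨z, hz⟩).trans hr

lemma le_kolmogorovNumber (T : X →L[ℂ] Y) {k : ℕ} (hk : 1 ≤ k) {r : ℝ}
    (h : ∀ L : Submodule ℂ Y, Module.rank ℂ L < (k : Cardinal) →
      ∃ x : X, ‖x‖ ≤ 1 ∧ ∀ z ∈ L, r ≤ ‖T x - z‖) : r ≤ kolmogorovNumber T k := by
  refine le_csInf ⟨_, ⊥, ?_, rfl⟩ ?_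
  · rw [rank_bot]; exact_mod_cast hk
  · rintro _ ⟨L, hL, rfl⟩
    obtain ⟨x, hx, hr⟩ := h L hL
    refine le_ciSup_of_le ⟨‖T‖, ?_⟩ ⟨x, hx⟩ (le_ciInf fun z => hr z z.2)
    rintro _ ⟨x, rfl⟩
    refine (ciInf_le ⟨0, ?_⟩ (0 : L)).trans ?_
    · rintro _ ⟨z, rfl⟩; exact norm_nonneg _
    · simpa using T.le_of_opNorm_le_of_le le_rfl x.2

end KolmogorovNumber

section UpperBound

lemma exists_submodule_norm_sub_le_min {p : ℝ≥0∞} [Fact (1 ≤ p)] (hp : p ≠ ∞) (hp2 : 2 ≤ p.toReal) :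
    ∃ C : ℝ, 0 < C ∧ ∀ N k : ℕ, 1 ≤ k → k ≤ N →
      ∃ L : Submodule ℂ (PiLp p fun _ : Fin N => ℂ), Module.rank ℂ L < (k : Cardinal) ∧
        ∀ y, ∃ z ∈ L, ‖y - z‖ ≤
          C * min 1 ((N : ℝ) ^ (p⁻¹).toReal * (k : ℝ) ^ (-(1/2) : ℝ)) * √(∑ j, ‖y j‖ ^ 2) := by
  set A := (1 + 2 * p.toReal ^ p.toReal * Real.exp 2) / (1 - Real.exp (-(2 / Real.pi ^ 2)))
    with hA
  have hc : 0 < 1 - Real.exp (-(2 / Real.pi ^ 2)) := by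
    rw [sub_pos, Real.exp_lt_one_iff]
    exact neg_lt_zero.2 (by positivity)
  have hA0 : 0 < A := by positivity
  refine ⟨1 + 2 * A * √2, by positivity, fun N k hk hkN => ?_⟩
  have hk0 : (0 : ℝ) < k := by exact_mod_cast hk
  have hN1 : (1 : ℝ) ≤ N := by exact_mod_cast hk.trans hkN
  set ξ := (N : ℝ) ^ (p⁻¹).toReal * (k : ℝ) ^ (-(1/2) : ℝ) with hξ
  rcases le_or_gt 1 ξ with h | h
  · refine ⟨⊥, by rw [rank_bot]; exact_mod_cast hk, fun y => ⟨0, Submodule.zero_mem _, ?_⟩⟩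
    rw [min_eq_left h, mul_one, sub_zero, PiLp.norm_eq_sum (by linarith)]
    have h1 := rpow_sum_rpow_anti Finset.univ (a := fun j => ‖y j‖) (fun j => norm_nonneg _)
      two_pos hp2
    simp only [Real.rpow_two] at h1
    rw [← Real.sqrt_eq_rpow] at h1
    refine h1.trans (le_mul_of_one_le_left (Real.sqrt_nonneg _) ?_)
    linarith [show 0 ≤ 2 * A * √2 by positivity]
  · have hk2 : 2 ≤ k := by
      by_contra hk2
      obtain rfl : k = 1 := by omega
      rw [hξ, Nat.cast_one, Real.one_rpow, mul_one] at h
      exact absurd h (not_lt.2 (Real.one_le_rpow hN1 ENNReal.toReal_nonneg))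
    obtain ⟨L, hL, hLy⟩ := exists_submodule_norm_sub_le hp (N := N) (m := k - 1)
      (by omega) (by omega)
    refine ⟨L, hL.trans_lt (by exact_mod_cast (by omega : k - 1 < k)), fun y => ?_⟩
    obtain ⟨z, hz, hyz⟩ := hLy y
    refine ⟨z, hz, hyz.trans ?_⟩
    rw [min_eq_right h.le]
    refine mul_le_mul_of_nonneg_right ?_ (Real.sqrt_nonneg _)
    have hm : (√((k - 1 : ℕ) : ℝ))⁻¹ ≤ √2 * (k : ℝ) ^ (-(1/2) : ℝ) := by
      rw [Real.rpow_neg hk0.le, ← Real.sqrt_eq_rpow, ← div_eq_mul_inv,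
        inv_le_comm₀ (Real.sqrt_pos.2 (by exact_mod_cast (by omega : 0 < k - 1))) (by positivity),
        inv_div, ← Real.sqrt_div hk0.le]
      refine Real.sqrt_le_sqrt ?_
      have h2k : (2 : ℝ) ≤ k := by exact_mod_cast hk2
      push_cast [hk]
      linarith
    calc 2 * (A * ((N : ℝ) ^ (1 / p.toReal) * (√((k - 1 : ℕ) : ℝ))⁻¹))
        ≤ 2 * (A * ((N : ℝ) ^ (1 / p.toReal) * (√2 * (k : ℝ) ^ (-(1/2) : ℝ)))) := by gcongr
      _ = 2 * A * √2 * ξ := by rw [hξ, ENNReal.toReal_inv, one_div]; ring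
      _ ≤ _ := by
        gcongr
        linarith

/-- Splitting a vector of the unit ball of `ℓ_p` at height `s` into an `ℓ_2` part and
an `ℓ_q` part. -/
lemma exists_split {n : Type*} [Fintype n] {p q s : ℝ} (hp : 2 ≤ p) (hpq : p < q) (hs : 0 < s)
    (x : n → ℂ) (hx : ∑ j, ‖x j‖ ^ p ≤ 1) :
    ∃ y : n → ℂ, √(∑ j, ‖y j‖ ^ 2) ≤ s ^ (1 - p / 2) ∧
      (∑ j, ‖x j - y j‖ ^ q) ^ (1 / q) ≤ s ^ (1 - p / q) := by
  have hp0 : 0 < p := by linarith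
  have hq0 : 0 < q := by linarith
  have aux : ∀ (e : ℝ) (w : n → ℂ), 0 < e → (∀ j, ‖w j‖ ^ e ≤ s ^ (e - p) * ‖x j‖ ^ p) →
      (∑ j, ‖w j‖ ^ e) ^ (1 / e) ≤ s ^ (1 - p / e) := by
    intro e w he hw
    calc (∑ j, ‖w j‖ ^ e) ^ (1 / e) ≤ (s ^ (e - p) * 1) ^ (1 / e) := by
          gcongr
          calc ∑ j, ‖w j‖ ^ e ≤ ∑ j, s ^ (e - p) * ‖x j‖ ^ p := Finset.sum_le_sum fun j _ => hw j
            _ ≤ s ^ (e - p) * 1 := by rw [← Finset.mul_sum]; gcongr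
      _ = s ^ (1 - p / e) := by
          rw [mul_one, ← Real.rpow_mul hs.le]
          congr 1
          field_simp
  refine ⟨fun j => if s < ‖x j‖ then x j else 0, ?_, aux q _ hq0 fun j => ?_⟩
  · have := aux 2 (fun j => if s < ‖x j‖ then x j else 0) two_pos fun j => ?_
    · simpa only [Real.rpow_two, ← Real.sqrt_eq_rpow] using this
    · split_ifs with h
      · have hx0 : 0 < ‖x j‖ := hs.trans h
        calc ‖x j‖ ^ (2 : ℝ) = ‖x j‖ ^ (2 - p) * ‖x j‖ ^ p := by
              rw [← Real.rpow_add hx0]; congr 1; ring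
          _ ≤ _ := by
              exact mul_le_mul_of_nonneg_right
                (Real.rpow_le_rpow_of_nonpos hs h.le (by linarith)) (by positivity)
      · rw [norm_zero, Real.zero_rpow two_ne_zero]; positivity
  · dsimp only
    split_ifs with h
    · rw [sub_self, norm_zero, Real.zero_rpow hq0.ne']; positivity
    · rw [sub_zero]
      calc ‖x j‖ ^ q = ‖x j‖ ^ (q - p) * ‖x j‖ ^ p := by
            rw [← Real.rpow_add_of_nonneg (norm_nonneg _) (by linarith) hp0.le]; congr 1; ring
        _ ≤ _ := by
            exact mul_le_mul_of_nonneg_right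
              (Real.rpow_le_rpow (norm_nonneg _) (not_lt.1 h) (by linarith)) (by positivity)

lemma exists_kolmogorovNumber_lpId_le (p₁ p₂ : ℝ≥0∞) [Fact (1 ≤ p₁)] [Fact (1 ≤ p₂)]
    (hp₁ : 2 ≤ p₁.toReal) (hp : p₁.toReal < p₂.toReal) (hp₂ : p₂ ≠ ∞) :
    ∃ C : ℝ, 0 < C ∧ ∀ N k : ℕ, 1 ≤ k → k ≤ N →
      kolmogorovNumber (lpId p₁ p₂ N) k
        ≤ C * (min 1 ((N : ℝ) ^ ((p₂⁻¹).toReal) * (k : ℝ) ^ (-(1/2) : ℝ)))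
          ^ (((p₁⁻¹).toReal - (p₂⁻¹).toReal) / (1/2 - (p₂⁻¹).toReal)) := by
  obtain ⟨C, hC, h⟩ := exists_submodule_norm_sub_le_min hp₂ (by linarith)
  refine ⟨C + 1, by positivity, fun N k hk hkN => ?_⟩
  obtain ⟨L, hL, hLy⟩ := h N k hk hkN
  have hk0 : (0 : ℝ) < k := by exact_mod_cast hk
  have hN0 : (0 : ℝ) < N := by exact_mod_cast hk.trans hkN
  set ξ := min 1 ((N : ℝ) ^ ((p₂⁻¹).toReal) * (k : ℝ) ^ (-(1/2) : ℝ))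
  have hξ : 0 < ξ := lt_min one_pos (by positivity)
  rw [ENNReal.toReal_inv, ENNReal.toReal_inv]
  set p := p₁.toReal
  set q := p₂.toReal
  have hp0 : 0 < p := by linarith
  have hq0 : 0 < q := by linarith
  have hq2 : q - 2 ≠ 0 := by linarith
  have hd : 1 / 2 - q⁻¹ ≠ 0 := by
    have : q⁻¹ < 2⁻¹ := inv_strictAnti₀ two_pos (by linarith)
    linarith
  refine kolmogorovNumber_le _ L hL fun x hx => ?_
  have hx' : ∑ j, ‖x j‖ ^ p ≤ 1 := by
    rw [PiLp.norm_eq_sum hp0] at hx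
    by_contra! hcon
    exact absurd hx (not_le.2 (Real.one_lt_rpow hcon (by positivity)))
  obtain ⟨y, hy2, hyq⟩ := exists_split hp₁ hp
    (Real.rpow_pos_of_pos hξ (1 / (p * (1 / 2 - q⁻¹)))) x hx'
  obtain ⟨z, hz, hyz⟩ := hLy (WithLp.toLp p₂ y)
  refine ⟨z, hz, ?_⟩
  have e1 : ξ * (ξ ^ (1 / (p * (1 / 2 - q⁻¹)))) ^ (1 - p / 2) =
      ξ ^ ((p⁻¹ - q⁻¹) / (1 / 2 - q⁻¹)) := by
    rw [← Real.rpow_mul hξ.le]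
    nth_rw 1 [← Real.rpow_one ξ]
    rw [← Real.rpow_add hξ]
    congr 1
    field_simp
    ring
  have e2 : (ξ ^ (1 / (p * (1 / 2 - q⁻¹)))) ^ (1 - p / q) =
      ξ ^ ((p⁻¹ - q⁻¹) / (1 / 2 - q⁻¹)) := by
    rw [← Real.rpow_mul hξ.le]
    congr 1
    field_simp
  rw [e2] at hyq
  have h1 : ‖WithLp.toLp p₂ y - z‖ ≤ C * ξ ^ ((p⁻¹ - q⁻¹) / (1 / 2 - q⁻¹)) := by
    refine hyz.trans ?_
    rw [← e1, ← mul_assoc]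
    gcongr
  have h2 : ‖lpId p₁ p₂ N x - WithLp.toLp p₂ y‖ ≤ ξ ^ ((p⁻¹ - q⁻¹) / (1 / 2 - q⁻¹)) := by
    rw [PiLp.norm_eq_sum hq0]
    exact hyq
  calc ‖lpId p₁ p₂ N x - z‖
      ≤ ‖lpId p₁ p₂ N x - WithLp.toLp p₂ y‖ + ‖WithLp.toLp p₂ y - z‖ :=
        norm_sub_le_norm_sub_add_norm_sub _ _ _
    _ ≤ _ := by linarith

end UpperBound

section LowerBound

lemma exists_subset_sum_le {N s : ℕ} (hs : s ≤ N) (a : Fin N → ℝ) :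
    ∃ S : Finset (Fin N), S.card = s ∧ N * ∑ i ∈ S, a i ≤ s * ∑ i, a i := by
  rcases Nat.eq_zero_or_pos N with rfl | hN
  · obtain rfl : s = 0 := by omega
    exact ⟨∅, by simp⟩
  have : NeZero N := ⟨hN.ne'⟩
  obtain ⟨S, -, hS⟩ := Finset.exists_subset_card_eq (s := (Finset.univ : Finset (Fin N)))
    (n := s) (by simpa using hs)
  have hsum : ∑ j : Fin N, ∑ i ∈ S, a (i + j) = s * ∑ i, a i := by
    rw [Finset.sum_comm]
    have : ∀ i ∈ S, ∑ j, a (i + j) = ∑ j, a j := fun i _ => Equiv.sum_comp (Equiv.addLeft i) a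
    rw [Finset.sum_congr rfl this, Finset.sum_const, hS, nsmul_eq_mul]
  have : ∃ j : Fin N, N * ∑ i ∈ S, a (i + j) ≤ s * ∑ i, a i := by
    by_contra! hcon
    have h := Finset.sum_lt_sum_of_nonempty Finset.univ_nonempty fun j _ => hcon j
    rw [← Finset.mul_sum Finset.univ (fun j => ∑ i ∈ S, a (i + j)), hsum, Finset.sum_const,
      Finset.card_univ, Fintype.card_fin, nsmul_eq_mul] at h
    exact lt_irrefl _ h
  obtain ⟨j, hj⟩ := this
  exact ⟨S.map (addRightEmbedding j), by rw [Finset.card_map, hS], by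
    rw [Finset.sum_map]; exact hj⟩

lemma exists_sign_norm_sum_sq_le {ι E : Type*} [DecidableEq ι] [NormedAddCommGroup E]
    [InnerProductSpace ℂ E] (S : Finset ι) (v : ι → E) :
    ∃ σ : ι → ℂ, (∀ i, σ i = 1 ∨ σ i = -1) ∧ ‖∑ i ∈ S, σ i • v i‖ ^ 2 ≤ ∑ i ∈ S, ‖v i‖ ^ 2 := by
  induction S using Finset.induction_on with
  | empty => exact ⟨fun _ => 1, fun _ => Or.inl rfl, by simp⟩
  | insert i S hi ih =>
    obtain ⟨σ, hσ, h⟩ := ih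
    set w := ∑ i ∈ S, σ i • v i with hw
    have hupd : ∀ c : ℂ, ∑ j ∈ insert i S, Function.update σ i c j • v j = c • v i + w := by
      intro c
      rw [Finset.sum_insert hi, Function.update_self, hw]
      congr 1
      refine Finset.sum_congr rfl fun j hj => ?_
      rw [Function.update_of_ne (ne_of_mem_of_not_mem hj hi)]
    have hpar := parallelogram_law_with_norm ℂ w (v i)
    have hmain : ∃ c : ℂ, (c = 1 ∨ c = -1) ∧ ‖c • v i + w‖ ^ 2 ≤ ‖v i‖ ^ 2 + ‖w‖ ^ 2 := by
      by_contra! hcon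
      have h1 := hcon 1 (Or.inl rfl)
      have h2 := hcon (-1) (Or.inr rfl)
      rw [one_smul, add_comm (v i) w] at h1
      rw [neg_one_smul, neg_add_eq_sub] at h2
      nlinarith
    obtain ⟨c, hc, hcn⟩ := hmain
    refine ⟨Function.update σ i c, fun j => ?_, ?_⟩
    · rcases eq_or_ne j i with rfl | hj
      · simpa using hc
      · simpa [Function.update_of_ne hj] using hσ j
    · rw [hupd, Finset.sum_insert hi]
      linarith

lemma sum_norm_sq_starProjection {ι E : Type*} [Fintype ι] [NormedAddCommGroup E]
    [InnerProductSpace ℂ E] [FiniteDimensional ℂ E] (b : OrthonormalBasis ι ℂ E)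
    (L : Submodule ℂ E) :
    ∑ i, ‖L.starProjection (b i)‖ ^ 2 = Module.finrank ℂ L := by
  have hproj : LinearMap.IsProj L (L.starProjection : E →ₗ[ℂ] E) :=
    ⟨fun x => L.starProjection_apply_mem x, fun x hx => Submodule.starProjection_eq_self_iff.2 hx⟩
  have h := congrArg Complex.re (hproj.trace.symm.trans (LinearMap.trace_eq_sum_inner _ b))
  rw [Complex.natCast_re, Complex.re_sum] at h
  rw [h]
  refine Finset.sum_congr rfl fun i _ => ?_
  have := L.re_inner_starProjection_eq_normSq (b i)
  rw [ContinuousLinearMap.coe_coe, ← Submodule.inner_starProjection_left_eq_right]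
  exact this.symm

/-- A sign vector with `s` nonzero entries far from a given subspace of small dimension. -/
lemma exists_sparse_sign_far {q : ℝ≥0∞} [Fact (1 ≤ q)] (hq : 2 ≤ q.toReal) {N k s : ℕ}
    (hs : 0 < s) (hsN : s ≤ N)
    (hk : 4 * (k : ℝ) ≤ (N : ℝ) ^ (2 / q.toReal) * (s : ℝ) ^ (1 - 2 / q.toReal))
    (L : Submodule ℂ (PiLp q fun _ : Fin N => ℂ)) (hL : Module.rank ℂ L < (k : Cardinal)) :
    ∃ (S : Finset (Fin N)) (x : Fin N → ℂ), S.card = s ∧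
      (∀ i, ‖x i‖ = if i ∈ S then 1 else 0) ∧
      ∀ z ∈ L, (1 / 3) * (s : ℝ) ^ (1 / q.toReal) ≤ ‖WithLp.toLp q x - z‖ := by
  set e : PiLp q (fun _ : Fin N => ℂ) ≃ₗ[ℂ] EuclideanSpace ℂ (Fin N) :=
    (WithLp.linearEquiv q ℂ (Fin N → ℂ)).trans (WithLp.linearEquiv 2 ℂ (Fin N → ℂ)).symm
  set L' := L.map e.toLinearMap
  have hfin : Module.finrank ℂ L' ≤ k := by
    have h1 : Module.finrank ℂ L' = Module.finrank ℂ L := LinearEquiv.finrank_map_eq e L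
    rw [← Module.finrank_eq_rank] at hL
    have h2 : Module.finrank ℂ L < k := by exact_mod_cast hL
    omega
  set b := EuclideanSpace.basisFun (Fin N) ℂ with hb
  obtain ⟨S, hS, hSs⟩ := exists_subset_sum_le hsN fun i => ‖L'.starProjection (b i)‖ ^ 2
  rw [sum_norm_sq_starProjection] at hSs
  obtain ⟨σ, hσ, hσs⟩ := exists_sign_norm_sum_sq_le S fun i => L'.starProjection (b i)
  have hσn : ∀ i, ‖σ i‖ = 1 := fun i => by rcases hσ i with h | h <;> simp [h]
  set x : Fin N → ℂ := fun i => if i ∈ S then σ i else 0 with hx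
  have hxn : ∀ i, ‖x i‖ = if i ∈ S then 1 else 0 := fun i => by
    by_cases h : i ∈ S <;> simp [hx, h, hσn]
  refine ⟨S, x, hS, hxn, fun z hz => ?_⟩
  have hq0 : 0 < q.toReal := by linarith
  have hs0 : (0 : ℝ) < s := by exact_mod_cast hs
  have hN0 : (0 : ℝ) < N := by exact_mod_cast hs.trans_le hsN
  set r := q.toReal
  by_contra! hcon
  have hxnorm : ‖WithLp.toLp q x‖ = (s : ℝ) ^ (1 / r) := by
    rw [PiLp.norm_eq_sum hq0]
    change (∑ i, ‖x i‖ ^ r) ^ (1 / r) = _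
    have : ∀ i, ‖x i‖ ^ r = if i ∈ S then 1 else 0 := fun i => by
      rw [hxn]
      split_ifs <;> simp [hq0.ne']
    simp [this, hS]
  have hz : ‖z‖ ≤ (4 / 3) * (s : ℝ) ^ (1 / r) := by
    have := norm_sub_norm_le z (WithLp.toLp q x)
    rw [norm_sub_rev] at this
    linarith
  set X : EuclideanSpace ℂ (Fin N) := WithLp.toLp 2 x with hX
  have hXsum : X = ∑ i ∈ S, σ i • b i := by
    ext j
    simp [hX, hx, hb, Pi.single_apply]
  have hPX : ‖L'.starProjection X‖ ^ 2 ≤ s * k / N := by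
    rw [hXsum, map_sum]
    simp only [map_smul]
    rw [le_div_iff₀ hN0]
    calc _ ≤ (∑ i ∈ S, ‖L'.starProjection (b i)‖ ^ 2) * N := by gcongr
      _ ≤ s * (Module.finrank ℂ L' : ℝ) := by linarith
      _ ≤ s * k := by gcongr
  have hPX' : ‖L'.starProjection X‖ ≤
      (1 / 2) * (s : ℝ) ^ (1 - 1 / r) * (N : ℝ) ^ (1 / r - 1 / 2) := by
    refine (sq_le_sq₀ (norm_nonneg _) (by positivity)).1 (hPX.trans ?_)
    have e1 : ((s : ℝ) ^ (1 - 1 / r)) ^ 2 = s * (s : ℝ) ^ (1 - 2 / r) := by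
      rw [← Real.rpow_mul_natCast hs0.le, ← Real.rpow_one_add' hs0.le]
      · congr 1
        push_cast
        ring
      · have : 2 / r ≤ 1 := (div_le_one hq0).2 hq
        linarith
    have e2 : ((N : ℝ) ^ (1 / r - 1 / 2)) ^ 2 = (N : ℝ) ^ (2 / r) / N := by
      rw [← Real.rpow_mul_natCast hN0.le, ← Real.rpow_sub_one hN0.ne']
      congr 1
      push_cast
      ring
    rw [mul_pow, mul_pow, e1, e2, div_le_iff₀ hN0]
    calc (s : ℝ) * k = (s : ℝ) / 4 * (4 * k) := by ring
      _ ≤ (s : ℝ) / 4 * ((N : ℝ) ^ (2 / r) * (s : ℝ) ^ (1 - 2 / r)) := by gcongr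
      _ = _ := by field_simp; norm_num
  have hz2 : ‖e z‖ ≤ (N : ℝ) ^ (1 / 2 - 1 / r) * ‖z‖ := by
    have := rpow_sum_rpow_le_card_mul Finset.univ (a := fun i => ‖z i‖) (fun i => norm_nonneg _)
      two_pos hq
    rw [Finset.card_univ, Fintype.card_fin] at this
    rw [PiLp.norm_eq_sum hq0, PiLp.norm_eq_sum (by simp), ENNReal.toReal_ofNat]
    exact this
  have hin1 : ‖inner ℂ X (e z)‖ ≤ (2 / 3) * s := by
    have hmem : e z ∈ L' := ⟨z, ‹z ∈ L›, rfl⟩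
    have : inner ℂ X (e z) = inner ℂ (L'.starProjection X) (e z) := by
      rw [Submodule.inner_starProjection_left_eq_right,
        Submodule.starProjection_eq_self_iff.2 hmem]
    rw [this]
    calc _ ≤ ‖L'.starProjection X‖ * ‖e z‖ := norm_inner_le_norm _ _
      _ ≤ ((1 / 2) * (s : ℝ) ^ (1 - 1 / r) * (N : ℝ) ^ (1 / r - 1 / 2)) *
          ((N : ℝ) ^ (1 / 2 - 1 / r) * ((4 / 3) * (s : ℝ) ^ (1 / r))) := by
        gcongr
        exact hz2.trans (by gcongr)
      _ = (2 / 3) * ((s : ℝ) ^ (1 - 1 / r) * (s : ℝ) ^ (1 / r)) *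
          ((N : ℝ) ^ (1 / r - 1 / 2) * (N : ℝ) ^ (1 / 2 - 1 / r)) := by ring
      _ = (2 / 3) * s := by
        rw [← Real.rpow_add hs0, ← Real.rpow_add hN0]
        simp
  have hin2 : ‖inner ℂ X (X - e z)‖ < (1 / 3) * s := by
    have h1 : ‖inner ℂ X (X - e z)‖ ≤ ∑ i ∈ S, ‖(WithLp.toLp q x - z) i‖ := by
      rw [PiLp.inner_apply]
      refine (norm_sum_le _ _).trans ?_
      rw [← Finset.sum_subset (Finset.subset_univ S)]
      · refine Finset.sum_le_sum fun i hi => ?_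
        refine (norm_inner_le_norm _ _).trans (le_of_eq ?_)
        have : ‖X i‖ = 1 := by simp [hX, hxn, hi]
        rw [this, one_mul]
        rfl
      · intro i _ hi
        have : X i = 0 := by simp [hX, hx, hi]
        simp [this]
    have h2 := rpow_sum_rpow_le_card_mul S (a := fun i => ‖(WithLp.toLp q x - z) i‖)
      (fun i => norm_nonneg _) one_pos (by linarith : (1 : ℝ) ≤ r)
    simp only [Real.rpow_one, div_one] at h2
    have h3 : (∑ i ∈ S, ‖(WithLp.toLp q x - z) i‖ ^ r) ^ (1 / r) ≤ ‖WithLp.toLp q x - z‖ := by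
      rw [PiLp.norm_eq_sum hq0]
      gcongr
      exact Finset.subset_univ S
    rw [hS] at h2
    calc _ ≤ (s : ℝ) ^ (1 - 1 / r) * ‖WithLp.toLp q x - z‖ :=
          h1.trans (h2.trans (by gcongr))
      _ < (s : ℝ) ^ (1 - 1 / r) * ((1 / 3) * (s : ℝ) ^ (1 / r)) := by gcongr
      _ = (1 / 3) * ((s : ℝ) ^ (1 - 1 / r) * (s : ℝ) ^ (1 / r)) := by ring
      _ = (1 / 3) * s := by rw [← Real.rpow_add hs0]; simp
  have hin : ‖inner ℂ X X‖ = (s : ℝ) := by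
    rw [inner_self_eq_norm_sq_to_K, norm_pow, RCLike.norm_ofReal, abs_norm,
      EuclideanSpace.norm_sq_eq]
    simp [hX, hxn, hS]
  have : inner ℂ X X = inner ℂ X (X - e z) + inner ℂ X (e z) := by
    rw [← inner_add_right, sub_add_cancel]
  have h4 := norm_add_le (inner ℂ X (X - e z)) (inner ℂ X (e z))
  rw [← this, hin] at h4
  linarith

/-- Any proper subspace is far from some vector of the unit ball. -/
lemma exists_far_of_rank_lt {p₁ p₂ : ℝ≥0∞} [Fact (1 ≤ p₁)] [Fact (1 ≤ p₂)]
    (hp₁ : 0 < p₁.toReal) (hp : p₁.toReal ≤ p₂.toReal) {N : ℕ} (hN : 0 < N)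
    (L : Submodule ℂ (PiLp p₂ fun _ : Fin N => ℂ)) (hL : Module.rank ℂ L < (N : Cardinal)) :
    ∃ x : PiLp p₁ fun _ : Fin N => ℂ, ‖x‖ ≤ 1 ∧ ∀ z ∈ L,
      (1 / 2) * (N : ℝ) ^ (1 / p₂.toReal - 1 / p₁.toReal) ≤ ‖lpId p₁ p₂ N x - z‖ := by
  have hN0 : (0 : ℝ) < N := by exact_mod_cast hN
  have hne : ∃ x, x ∉ L := by
    by_contra! hcon
    have : L = ⊤ := by ext x; simp [hcon x]
    rw [this, rank_top, (WithLp.linearEquiv p₂ ℂ (Fin N → ℂ)).rank_eq, rank_fin_fun] at hL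
    exact lt_irrefl _ hL
  obtain ⟨x, hxL, hx⟩ := riesz_lemma (Submodule.closed_of_finiteDimensional L) hne
    (r := 1 / 2) (by norm_num)
  set x' : PiLp p₁ fun _ : Fin N => ℂ := WithLp.toLp p₁ x.ofLp with hx'
  have hxx : lpId p₁ p₂ N x' = x := rfl
  have hx0 : 0 < ‖x'‖ := by
    rw [norm_pos_iff]
    intro h
    rw [h, map_zero] at hxx
    exact hxL (hxx ▸ L.zero_mem)
  have hle : ‖x'‖ ≤ (N : ℝ) ^ (1 / p₁.toReal - 1 / p₂.toReal) * ‖x‖ := by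
    have := rpow_sum_rpow_le_card_mul Finset.univ (a := fun i => ‖x i‖) (fun i => norm_nonneg _)
      hp₁ hp
    rw [Finset.card_univ, Fintype.card_fin] at this
    rw [PiLp.norm_eq_sum hp₁, PiLp.norm_eq_sum (hp₁.trans_le hp)]
    exact this
  refine ⟨((‖x'‖⁻¹ : ℝ) : ℂ) • x', ?_, fun z hz => ?_⟩
  · rw [norm_smul]
    simp [hx0.ne']
  · have h1 := hx (((‖x'‖ : ℝ) : ℂ) • z) (L.smul_mem _ hz)
    have h2 : x - ((‖x'‖ : ℝ) : ℂ) • z =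
        ((‖x'‖ : ℝ) : ℂ) • (lpId p₁ p₂ N (((‖x'‖⁻¹ : ℝ) : ℂ) • x') - z) := by
      rw [map_smul, hxx, smul_sub, smul_smul, ← Complex.ofReal_mul, mul_inv_cancel₀ hx0.ne']
      simp
    rw [h2, norm_smul, Complex.norm_real, Real.norm_of_nonneg hx0.le] at h1
    refine le_of_mul_le_mul_left ?_ hx0
    refine le_trans ?_ h1
    calc ‖x'‖ * ((1 / 2) * (N : ℝ) ^ (1 / p₂.toReal - 1 / p₁.toReal))
        ≤ ((N : ℝ) ^ (1 / p₁.toReal - 1 / p₂.toReal) * ‖x‖) *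
          ((1 / 2) * (N : ℝ) ^ (1 / p₂.toReal - 1 / p₁.toReal)) := by gcongr
      _ = 1 / 2 * ‖x‖ * ((N : ℝ) ^ (1 / p₁.toReal - 1 / p₂.toReal) *
          (N : ℝ) ^ (1 / p₂.toReal - 1 / p₁.toReal)) := by ring
      _ = 1 / 2 * ‖x‖ := by rw [← Real.rpow_add hN0]; simp

/-- The choice of the sparsity level for a given `η ≤ 1`. -/
lemma exists_nat_rpow_bounds {β η : ℝ} (hβ : 0 < β) (hη : 0 < η) (hη1 : η ≤ 1) {N : ℕ}
    (hN : η ^ (-β) ≤ N) :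
    ∃ s : ℕ, 0 < s ∧ s ≤ N ∧ η ^ (-β) ≤ s ∧ (s : ℝ) ≤ 2 * η ^ (-β) := by
  have h1 : 1 ≤ η ^ (-β) := Real.one_le_rpow_of_pos_of_le_one_of_nonpos hη hη1 (by linarith)
  refine ⟨⌈η ^ (-β)⌉₊, Nat.ceil_pos.2 (by linarith), Nat.ceil_le.2 hN, Nat.le_ceil _, ?_⟩
  linarith [Nat.ceil_lt_add_one (show 0 ≤ η ^ (-β) by linarith)]

lemma exists_far_of_four_mul_le {p₁ p₂ : ℝ≥0∞} [Fact (1 ≤ p₁)] [Fact (1 ≤ p₂)]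
    (hp₁ : 0 < p₁.toReal) (hp : p₁.toReal < p₂.toReal) (hp₂ : 2 < p₂.toReal) {N k : ℕ} (hk : 1 ≤ k)
    (hkN : 4 * k ≤ N) (L : Submodule ℂ (PiLp p₂ fun _ : Fin N => ℂ))
    (hL : Module.rank ℂ L < (k : Cardinal)) :
    ∃ x : PiLp p₁ fun _ : Fin N => ℂ, ‖x‖ ≤ 1 ∧ ∀ z ∈ L,
      (1 / 3) * 2 ^ (1 / p₂.toReal - 1 / p₁.toReal) *
        (min 1 ((N : ℝ) ^ (1 / p₂.toReal) * (k : ℝ) ^ (-(1 / 2) : ℝ) / 2)) ^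
          ((1 / p₁.toReal - 1 / p₂.toReal) / (1 / 2 - 1 / p₂.toReal)) ≤ ‖lpId p₁ p₂ N x - z‖ := by
  have hk0 : (0 : ℝ) < k := by exact_mod_cast hk
  have hkN' : 4 * (k : ℝ) ≤ N := by exact_mod_cast hkN
  have hN0 : (0 : ℝ) < N := by linarith
  have hp₂0 : 0 < p₂.toReal := by linarith
  have hd : 0 < 1 / 2 - 1 / p₂.toReal := sub_pos.2 (one_div_lt_one_div_of_lt two_pos hp₂)
  have hα : 1 / p₂.toReal - 1 / p₁.toReal ≤ 0 :=
    sub_nonpos.2 (one_div_le_one_div_of_le hp₁ hp.le)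
  have hsq : ((k : ℝ) ^ (-(1 / 2) : ℝ) / 2) = (4 * k : ℝ) ^ (-(1 / 2) : ℝ) := by
    rw [Real.mul_rpow (by norm_num) hk0.le, show (4 : ℝ) = 2 ^ (2 : ℝ) by norm_num,
      ← Real.rpow_mul two_pos.le]
    norm_num
    ring
  rw [mul_div_assoc, hsq]
  set β := 1 / (1 / 2 - 1 / p₂.toReal) with hβ
  have hβ0 : 0 < β := by positivity
  set η := min 1 ((N : ℝ) ^ (1 / p₂.toReal) * (4 * k : ℝ) ^ (-(1 / 2) : ℝ)) with hη
  have hη0 : 0 < η := lt_min one_pos (by positivity)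
  have hηN : η ^ (-β) ≤ N := by
    have h1 : (N : ℝ) ^ (1 / p₂.toReal - 1 / 2) ≤ η := by
      refine le_min (Real.rpow_le_one_of_one_le_of_nonpos ?_ (by linarith)) ?_
      · exact_mod_cast (by omega : 1 ≤ N)
      · rw [sub_eq_add_neg, Real.rpow_add hN0]
        gcongr ?_ * ?_
        exact Real.rpow_le_rpow_of_nonpos (by positivity) hkN' (by norm_num)
    calc η ^ (-β) ≤ ((N : ℝ) ^ (1 / p₂.toReal - 1 / 2)) ^ (-β) :=
          Real.rpow_le_rpow_of_nonpos (by positivity) h1 (by linarith)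
      _ = (N : ℝ) ^ (1 : ℝ) := by
          rw [← Real.rpow_mul hN0.le]
          congr 1
          rw [← neg_sub (1 / 2 : ℝ), neg_mul_neg, hβ, mul_one_div_cancel hd.ne']
      _ = N := Real.rpow_one _
  obtain ⟨s, hs, hsN, hs1, hs2⟩ := exists_nat_rpow_bounds hβ0 hη0 (min_le_left _ _) hηN
  have hs0 : (0 : ℝ) < s := by exact_mod_cast hs
  have hcond : 4 * (k : ℝ) ≤ (N : ℝ) ^ (2 / p₂.toReal) * (s : ℝ) ^ (1 - 2 / p₂.toReal) := by
    have he : 0 ≤ 1 - 2 / p₂.toReal := by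
      have : 1 - 2 / p₂.toReal = 2 * (1 / 2 - 1 / p₂.toReal) := by ring
      rw [this]
      positivity
    have h1 : η ^ (-2 : ℝ) ≤ (s : ℝ) ^ (1 - 2 / p₂.toReal) := by
      calc η ^ (-2 : ℝ) = (η ^ (-β)) ^ (1 - 2 / p₂.toReal) := by
            rw [← Real.rpow_mul hη0.le]
            congr 1
            have : 1 - 2 / p₂.toReal = 2 * (1 / 2 - 1 / p₂.toReal) := by ring
            rw [this, neg_mul, mul_left_comm, hβ, one_div_mul_cancel hd.ne', mul_one]
        _ ≤ _ := by gcongr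
    have h2 : ((N : ℝ) ^ (1 / p₂.toReal) * (4 * k : ℝ) ^ (-(1 / 2) : ℝ)) ^ (-2 : ℝ)
        ≤ η ^ (-2 : ℝ) :=
      Real.rpow_le_rpow_of_nonpos hη0 (min_le_right _ _) (by norm_num)
    calc 4 * (k : ℝ) = (N : ℝ) ^ (2 / p₂.toReal) *
          ((N : ℝ) ^ (1 / p₂.toReal) * (4 * k : ℝ) ^ (-(1 / 2) : ℝ)) ^ (-2 : ℝ) := by
          rw [Real.mul_rpow (by positivity) (by positivity), ← Real.rpow_mul hN0.le,
            ← Real.rpow_mul (by positivity), ← mul_assoc, ← Real.rpow_add hN0,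
            show 2 / p₂.toReal + 1 / p₂.toReal * -2 = 0 by ring,
            show (-(1 / 2) * -2 : ℝ) = 1 by norm_num]
          simp
      _ ≤ _ := by
          gcongr
          exact h2.trans h1
  obtain ⟨S, x, hS, hxn, hx⟩ := exists_sparse_sign_far hp₂.le hs hsN hcond L hL
  set c : ℝ := (s : ℝ) ^ (1 / p₁.toReal) with hc
  have hc0 : 0 < c := by positivity
  refine ⟨((c⁻¹ : ℝ) : ℂ) • WithLp.toLp p₁ x, ?_, fun z hz => ?_⟩
  · have : ‖WithLp.toLp p₁ x‖ = c := by
      rw [PiLp.norm_eq_sum hp₁]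
      change (∑ i, ‖x i‖ ^ p₁.toReal) ^ (1 / p₁.toReal) = _
      have : ∀ i, ‖x i‖ ^ p₁.toReal = if i ∈ S then 1 else 0 := fun i => by
        rw [hxn]
        split_ifs <;> simp [hp₁.ne']
      simp [this, hS, hc]
    rw [norm_smul, this]
    simp [hc0.ne', abs_of_pos hc0]
  · have h1 := hx (((c : ℝ) : ℂ) • z) (L.smul_mem _ hz)
    have h2 : WithLp.toLp p₂ x - ((c : ℝ) : ℂ) • z =
        ((c : ℝ) : ℂ) • (lpId p₁ p₂ N (((c⁻¹ : ℝ) : ℂ) • WithLp.toLp p₁ x) - z) := by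
      rw [map_smul, smul_sub, smul_smul, ← Complex.ofReal_mul, mul_inv_cancel₀ hc0.ne',
        Complex.ofReal_one, one_smul]
      rfl
    rw [h2, norm_smul, Complex.norm_real, Real.norm_of_nonneg hc0.le] at h1
    refine le_trans ?_ ((div_le_iff₀' hc0).2 h1)
    rw [mul_div_assoc, hc, ← Real.rpow_sub hs0, mul_assoc]
    gcongr
    calc (2 : ℝ) ^ (1 / p₂.toReal - 1 / p₁.toReal) *
          η ^ ((1 / p₁.toReal - 1 / p₂.toReal) / (1 / 2 - 1 / p₂.toReal))
        = (2 * η ^ (-β)) ^ (1 / p₂.toReal - 1 / p₁.toReal) := by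
          rw [Real.mul_rpow two_pos.le (by positivity), ← Real.rpow_mul hη0.le]
          congr 2
          rw [hβ]
          ring
      _ ≤ _ := Real.rpow_le_rpow_of_nonpos hs0 hs2 hα

lemma le_kolmogorovNumber_lpId (p₁ p₂ : ℝ≥0∞) [Fact (1 ≤ p₁)] [Fact (1 ≤ p₂)]
    (hp₁ : 0 < p₁.toReal) (hp : p₁.toReal < p₂.toReal) (hp₂ : 2 < p₂.toReal) :
    ∃ c : ℝ, 0 < c ∧ ∀ N k : ℕ, 1 ≤ k → k ≤ N →
      c * (min 1 ((N : ℝ) ^ ((p₂⁻¹).toReal) * (k : ℝ) ^ (-(1/2) : ℝ)))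
          ^ (((p₁⁻¹).toReal - (p₂⁻¹).toReal) / (1/2 - (p₂⁻¹).toReal))
        ≤ kolmogorovNumber (lpId p₁ p₂ N) k := by
  simp only [ENNReal.toReal_inv, ← one_div p₁.toReal, ← one_div p₂.toReal]
  have hd : 0 < 1 / 2 - 1 / p₂.toReal := sub_pos.2 (one_div_lt_one_div_of_lt two_pos hp₂)
  have hα : 0 < 1 / p₁.toReal - 1 / p₂.toReal := sub_pos.2 (one_div_lt_one_div_of_lt hp₁ hp)
  set θ := (1 / p₁.toReal - 1 / p₂.toReal) / (1 / 2 - 1 / p₂.toReal) with hθ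
  have hθ0 : 0 < θ := by positivity
  refine ⟨(1 / 3) * 2 ^ (1 / p₂.toReal - 1 / p₁.toReal) * 2 ^ (-θ), by positivity,
    fun N k hk hkN => le_kolmogorovNumber _ hk fun L hL => ?_⟩
  have hk0 : (0 : ℝ) < k := by exact_mod_cast hk
  have hN0 : (0 : ℝ) < N := by exact_mod_cast hk.trans hkN
  set ζ := (N : ℝ) ^ (1 / p₂.toReal) * (k : ℝ) ^ (-(1 / 2) : ℝ) with hζ
  have hζ0 : 0 < ζ := by positivity
  have hhalf : ∀ t : ℝ, 0 ≤ t → 2 ^ (-θ) * t ^ θ = (t / 2) ^ θ := fun t ht => by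
    rw [Real.div_rpow ht two_pos.le, Real.rpow_neg two_pos.le]
    ring
  rw [mul_assoc, hhalf _ (by positivity)]
  rcases le_or_gt (4 * k) N with h | h
  · obtain ⟨x, hx, hxL⟩ := exists_far_of_four_mul_le hp₁ hp hp₂ hk h L hL
    refine ⟨x, hx, fun z hz => le_trans ?_ (hxL z hz)⟩
    gcongr
    refine le_min ?_ (by gcongr; exact min_le_right _ _)
    linarith [min_le_left 1 ζ]
  · obtain ⟨x, hx, hxL⟩ := exists_far_of_rank_lt hp₁ hp.le (hk.trans hkN) L
      (hL.trans_le (by exact_mod_cast hkN))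
    refine ⟨x, hx, fun z hz => le_trans ?_ (hxL z hz)⟩
    have h4 : ζ / 2 ≤ (N : ℝ) ^ (1 / p₂.toReal - 1 / 2) := by
      have h4k : (N : ℝ) / 4 ≤ k := by
        have : (N : ℝ) < 4 * k := by exact_mod_cast h
        linarith
      calc ζ / 2 ≤ (N : ℝ) ^ (1 / p₂.toReal) * ((N : ℝ) / 4) ^ (-(1 / 2) : ℝ) / 2 := by
            rw [hζ]
            gcongr ?_ * ?_ / _
            exact Real.rpow_le_rpow_of_nonpos (by positivity) h4k (by norm_num)
        _ = (N : ℝ) ^ (1 / p₂.toReal - 1 / 2) := by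
            rw [Real.div_rpow hN0.le (by norm_num), show (4 : ℝ) = 2 ^ (2 : ℝ) by norm_num,
              ← Real.rpow_mul two_pos.le, sub_eq_add_neg, Real.rpow_add hN0]
            norm_num
            ring
    calc (1 / 3 : ℝ) * 2 ^ (1 / p₂.toReal - 1 / p₁.toReal) * (min 1 ζ / 2) ^ θ
        ≤ (1 / 2) * 1 * ((N : ℝ) ^ (1 / p₂.toReal - 1 / 2)) ^ θ := by
          gcongr
          · norm_num
          · exact Real.rpow_le_one_of_one_le_of_nonpos one_le_two (by linarith)
          · refine le_trans ?_ h4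
            gcongr
            exact min_le_right _ _
      _ = (1 / 2) * (N : ℝ) ^ (1 / p₂.toReal - 1 / p₁.toReal) := by
          rw [mul_one, ← Real.rpow_mul hN0.le]
          congr 2
          rw [hθ, ← neg_sub (1 / 2 : ℝ), neg_mul, mul_div_cancel₀ _ hd.ne', neg_sub]

end LowerBound

/-- If `2 ≤ p₁ < p₂ < ∞` and `θ = (1/p₁ - 1/p₂)/(1/2 - 1/p₂)`, then
`d_k(id : ℓ_{p₁}^N → ℓ_{p₂}^N) ∼ ξ^θ` for `k ≤ N`, where `ξ = min(1, N^{1/p₂} k^{-1/2})`. -/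
theorem stmt6 (p₁ p₂ : ℝ≥0∞) [Fact (1 ≤ p₁)] [Fact (1 ≤ p₂)]
    (h₁ : 2 ≤ p₁) (h₂ : p₁ < p₂) (h₃ : p₂ < ∞) :
    ∃ c₁ c₂ : ℝ, 0 < c₁ ∧ c₁ ≤ c₂ ∧
      ∀ N k : ℕ, 1 ≤ k → k ≤ N →
        c₁ * (min 1 ((N : ℝ) ^ ((p₂⁻¹).toReal) * (k : ℝ) ^ (-(1/2) : ℝ)))
              ^ (((p₁⁻¹).toReal - (p₂⁻¹).toReal) / (1/2 - (p₂⁻¹).toReal))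
            ≤ kolmogorovNumber (lpId p₁ p₂ N) k ∧
        kolmogorovNumber (lpId p₁ p₂ N) k
            ≤ c₂ * (min 1 ((N : ℝ) ^ ((p₂⁻¹).toReal) * (k : ℝ) ^ (-(1/2) : ℝ)))
              ^ (((p₁⁻¹).toReal - (p₂⁻¹).toReal) / (1/2 - (p₂⁻¹).toReal)) := by
  have hp₂ : p₂ ≠ ∞ := h₃.ne
  have hp₁ : p₁ ≠ ∞ := (h₂.trans h₃).ne
  have h2 : 2 ≤ p₁.toReal := by simpa using ENNReal.toReal_mono hp₁ h₁
  have hp : p₁.toReal < p₂.toReal := ENNReal.toReal_strict_mono hp₂ h₂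
  obtain ⟨c, hc, hlow⟩ := le_kolmogorovNumber_lpId p₁ p₂ (by linarith) hp (by linarith)
  obtain ⟨C, hC, hup⟩ := exists_kolmogorovNumber_lpId_le p₁ p₂ h2 hp hp₂
  refine ⟨c, max C c, hc, le_max_right _ _, fun N k hk hkN =>
    ⟨hlow N k hk hkN, (hup N k hk hkN).trans ?_⟩⟩
  gcongr
  exact le_max_left _ _
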